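/- Let a, c ∈ ℂ and N ∈ ℕ with N ≥ 1. Assume: a+c+m ≠ 0 for every integer 0 ≤ m ≤ 2N; a−c+1−ℓ+i ≠ 0 for all integers 0 ≤ ℓ ≤ N and 0 ≤ i ≤ N−1; 2a+i ≠ 0 for all 0 ≤ i ≤ N−1; 2a+N+i ≠ 0 for all 0 ≤ i ≤ N−1; 2a−1−2k ≠ 0 and (2a−1)ₖ ≠ 0 for all 0 ≤ k ≤ N; and W(ℓ) ≠ 0 and hₖ ≠ 0 for all 0 ≤ ℓ, k ≤ N, where W(ℓ) = binom(N,ℓ)·(1−a−c−N)_{N−ℓ}·(c−a)ₗ and hₖ = (−1)^N·[(1−2a)·(2a)_N/(1−2a−2k)]·[k!·(2a+N)ₖ/((−N)ₖ·(2a−1)ₖ)]. With Uₖ(ℓ; a, c', N) = Σ_{j=0}^{k} [(−k)ⱼ(−ℓ)ⱼ(k+2a−1)ⱼ] / [(a−c'−ℓ)ⱼ(−N)ⱼ·j!], the dual biorthogonality relation holds: for all 0 ≤ ℓ, ℓ' ≤ N, Σ_{k=0}^{N} (1/hₖ) · Uₖ(ℓ; a, c−1, N) · Uₖ(N−ℓ';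 a, −c−N, N) = δ_{ℓ,ℓ'} / W(ℓ), where δ is the Kronecker delta. -/

import Mathlib

/-- The Pochhammer symbol `(z)ₘ = z (z+1) ⋯ (z+m-1)`. -/
noncomputable def poch (z : ℂ) (m : ℕ) : ℂ := ∏ i ∈ Finset.range m, (z + i)

/-- The Hahn rational function
`Uₖ(ℓ; a, c', N) = Σ_{j=0}^{k} (-k)ⱼ (-ℓ)ⱼ (k+2a-1)ⱼ / ((a-c'-ℓ)ⱼ (-N)ⱼ j!)`. -/
noncomputable def hahnU (a c' : ℂ) (N k : ℕ) (l : ℂ) : ℂ :=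
  ∑ j ∈ Finset.range (k + 1),
    (poch (-(k : ℂ)) j * poch (-l) j * poch ((k : ℂ) + 2 * a - 1) j) /
      (poch (a - c' - l) j * poch (-(N : ℂ)) j * (Nat.factorial j : ℂ))

/-- The biorthogonality weight `W(ℓ) = binom(N, ℓ) (1-a-c-N)_{N-ℓ} (c-a)ₗ`. -/
noncomputable def hahnW (a c : ℂ) (N l : ℕ) : ℂ :=
  (Nat.choose N l : ℂ) * poch (1 - a - c - N) (N - l) * poch (c - a) l

/-- The normalization
`hₖ = (-1)^N ((1-2a)(2a)_N / (1-2a-2k)) (k! (2a+N)ₖ / ((-N)ₖ (2a-1)ₖ))`. -/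
noncomputable def hahnH (a : ℂ) (N k : ℕ) : ℂ :=
  (-1 : ℂ) ^ N * ((1 - 2 * a) * poch (2 * a) N / (1 - 2 * a - 2 * k)) *
    ((Nat.factorial k : ℂ) * poch (2 * a + N) k /
      (poch (-(N : ℂ)) k * poch (2 * a - 1) k))

theorem poch_zero (z : ℂ) : poch z 0 = 1 := by simp [poch]

theorem poch_succ (z : ℂ) (m : ℕ) : poch z (m + 1) = poch z m * (z + m) := by
  simp [poch, Finset.prod_range_succ]

theorem poch_add (z : ℂ) (m n : ℕ) : poch z (m + n) = poch z m * poch (z + m) n := by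
  simp only [poch, Finset.prod_range_add, Nat.cast_add, add_assoc]

theorem poch_succ_left (z : ℂ) (m : ℕ) : poch z (m + 1) = z * poch (z + 1) m := by
  rw [add_comm, poch_add, poch_succ, poch_zero]; simp

/-- Shifting the base point of a Pochhammer symbol by one, in polynomial form. -/
theorem mul_poch_add_one (z : ℂ) (m : ℕ) : z * poch (z + 1) m = poch z m * (z + m) := by
  rw [← poch_succ_left, poch_succ]

theorem poch_reflect (z : ℂ) (m : ℕ) : poch z m = (-1) ^ m * poch (1 - z - m) m := by
  induction m generalizing z with
  | zero => simp [poch_zero]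
  | succ m ih =>
    rw [poch_succ, ih, poch_succ_left, pow_succ]
    push_cast
    rw [show 1 - z - ((m : ℂ) + 1) + 1 = 1 - z - m by ring]
    ring

theorem poch_neg_natCast (n j : ℕ) :
    poch (-(n : ℂ)) j = (-1) ^ j * (n.choose j * j.factorial) := by
  induction j with
  | zero => simp [poch_zero]
  | succ j ih =>
    rw [poch_succ, ih, pow_succ, Nat.factorial_succ]
    rcases lt_or_ge n j with h | h
    · rw [Nat.choose_eq_zero_of_lt h, Nat.choose_eq_zero_of_lt (by omega)]; simp
    · have := congrArg (Nat.cast : ℕ → ℂ) (Nat.choose_succ_right_eq n j)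
      push_cast [Nat.cast_sub h] at this ⊢
      linear_combination (-1) ^ j * (j.factorial : ℂ) * this

theorem poch_neg_natCast_of_lt {n j : ℕ} (h : n < j) : poch (-(n : ℂ)) j = 0 := by
  rw [poch_neg_natCast, Nat.choose_eq_zero_of_lt h]; simp

theorem poch_neg_natCast_ne_zero {n j : ℕ} (h : j ≤ n) : poch (-(n : ℂ)) j ≠ 0 := by
  rw [poch_neg_natCast]
  have := (Nat.choose_pos h).ne'
  have := j.factorial_ne_zero
  simp [*]

theorem poch_ne_zero {z : ℂ} {m : ℕ} (h : ∀ i < m, z + i ≠ 0) : poch z m ≠ 0 :=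
  Finset.prod_ne_zero_iff.2 fun i hi => h i (Finset.mem_range.1 hi)

theorem sum_range_eq_sum_shift (f : ℕ → ℂ) {i n : ℕ} (hi : i ≤ n) (hf : ∀ j < i, f j = 0) :
    ∑ j ∈ Finset.range (n + 1), f j = ∑ m ∈ Finset.range (n - i + 1), f (i + m) := by
  rw [show n + 1 = i + (n - i + 1) by omega, Finset.sum_range_add,
    Finset.sum_eq_zero fun j hj => hf j (Finset.mem_range.1 hj), zero_add]

theorem sum_range_extend (f : ℕ → ℂ) {n N : ℕ} (h : n ≤ N) (hf : ∀ j, n < j → f j = 0) :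
    ∑ j ∈ Finset.range (n + 1), f j = ∑ j ∈ Finset.range (N + 1), f j := by
  refine Finset.sum_subset (by simpa using h) fun j _ hj => hf j ?_
  simpa using hj

/-- The Chu–Vandermonde summation in polynomial form. -/
theorem chu_vandermonde (M : ℕ) (b d : ℂ) :
    ∑ m ∈ Finset.range (M + 1), (-1) ^ m * (M.choose m : ℂ) * poch b m * poch (d + m) (M - m)
      = poch (d - b) M := by
  induction M generalizing b d with
  | zero => simp [poch_zero]
  | succ M ih =>
    have hfirst : ∑ m ∈ Finset.range (M + 2),
        (-1) ^ m * (M.choose m : ℂ) * poch b m * poch (d + m) (M + 1 - m)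
          = (d + M) * poch (d - b) M := by
      rw [Finset.sum_range_succ, Nat.choose_succ_self, ← ih b d, Finset.mul_sum]
      simp only [Nat.cast_zero, mul_zero, zero_mul, add_zero]
      refine Finset.sum_congr rfl fun m hm => ?_
      have hm : m ≤ M := by simpa [Nat.lt_succ_iff] using hm
      rw [Nat.succ_sub hm, poch_succ, Nat.cast_sub hm]
      ring
    have hsecond : ∑ m ∈ Finset.range (M + 1),
        (-1) ^ (m + 1) * (M.choose m : ℂ) * poch b (m + 1) * poch (d + (m + 1 : ℕ)) (M - m)
          = -(b * poch (d - b) M) := by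
      rw [show d - b = (d + 1) - (b + 1) by ring, ← ih (b + 1) (d + 1), Finset.mul_sum,
        ← Finset.sum_neg_distrib]
      refine Finset.sum_congr rfl fun m _ => ?_
      rw [poch_succ_left, pow_succ]
      push_cast
      rw [show d + ((m : ℂ) + 1) = d + 1 + m by ring]
      ring
    rw [Finset.sum_range_succ'] at hfirst ⊢
    have hsplit : ∀ m ∈ Finset.range (M + 1),
        (-1) ^ (m + 1) * ((M + 1).choose (m + 1) : ℂ) * poch b (m + 1)
            * poch (d + (m + 1 : ℕ)) (M + 1 - (m + 1))
          = (-1) ^ (m + 1) * (M.choose (m + 1) : ℂ) * poch b (m + 1)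
              * poch (d + (m + 1 : ℕ)) (M + 1 - (m + 1))
            + (-1) ^ (m + 1) * (M.choose m : ℂ) * poch b (m + 1)
              * poch (d + (m + 1 : ℕ)) (M - m) := by
      intro m _
      rw [Nat.choose_succ_succ, Nat.add_sub_add_right]
      push_cast
      ring
    rw [Finset.sum_congr rfl hsplit, Finset.sum_add_distrib, hsecond, poch_succ]
    simp only [Nat.choose_zero_right] at hfirst ⊢
    linear_combination hfirst

/-- The Pfaff–Saalschütz summation as a connection formula: `(A)ⱼ(B)ⱼ` in terms of
`(E-A)ᵢ(E-B)ᵢ`. -/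
theorem pfaff_saalschutz (A B E : ℂ) (j : ℕ) :
    poch A j * poch B j = ∑ i ∈ Finset.range (j + 1),
      (j.choose i : ℂ) * poch (E + i) (j - i) * poch (A + B - E) (j - i)
        * (poch (E - A) i * poch (E - B) i) := by
  induction j with
  | zero => simp [poch_zero]
  | succ j ih =>
    set w := A + B - E with hw
    set t : ℕ → ℂ := fun i => (j.choose i : ℂ) * poch (E + i) (j - i) * poch w (j - i) with ht
    set Q : ℕ → ℂ := fun i => poch (E - A) i * poch (E - B) i with hQ
    have hrec : ∀ i ∈ Finset.range (j + 1),
        ((j + 1).choose (i + 1) : ℂ) * poch (E + (i + 1 : ℕ)) (j + 1 - (i + 1))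
            * poch w (j + 1 - (i + 1)) * Q (i + 1)
          = t i * Q (i + 1)
            + (j + E + (i + 1 : ℕ)) * (w + j - (i + 1 : ℕ)) * t (i + 1) * Q (i + 1) := by
      intro i hi
      rw [← add_mul]
      congr 1
      have hi : i ≤ j := by simpa [Nat.lt_succ_iff] using hi
      rcases hi.eq_or_lt with rfl | hlt
      · simp [ht, poch_zero]
      · obtain ⟨m, rfl⟩ := Nat.exists_eq_add_of_lt hlt
        have hc := congrArg (Nat.cast : ℕ → ℂ) (Nat.choose_succ_right_eq (i + m + 1) i)
        rw [show i + m + 1 - i = m + 1 by omega] at hc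
        simp only [ht]
        rw [Nat.choose_succ_succ, show i + m + 1 + 1 - (i + 1) = m + 1 by omega,
          show i + m + 1 - i = m + 1 by omega, show i + m + 1 - (i + 1) = m by omega,
          poch_succ w, poch_succ_left (E + i), poch_succ (E + (i + 1 : ℕ))]
        push_cast at hc ⊢
        rw [← add_assoc E]
        linear_combination (-poch (E + i + 1) m * poch w m * (w + m)) * hc
    rw [Finset.sum_range_succ', Finset.sum_congr rfl hrec, Finset.sum_add_distrib, add_assoc]
    have hzero : ((j + 1).choose 0 : ℂ) * poch (E + (0 : ℕ)) (j + 1 - 0) * poch w (j + 1 - 0) * Q 0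
        = (j + E + (0 : ℕ)) * (w + j - (0 : ℕ)) * t 0 * Q 0 := by
      simp only [ht, Nat.choose_zero_right, Nat.sub_zero, poch_succ, Nat.cast_zero]
      ring
    have hlast : t (j + 1) = 0 := by simp [ht]
    change _ = _ + (_ + ((j + 1).choose 0 : ℂ) * _ * _ * Q 0)
    rw [hzero, ← Finset.sum_range_succ'
      (fun i => (j + E + (i : ℕ)) * (w + j - (i : ℕ)) * t i * Q i), Finset.sum_range_succ _ (j + 1),
      hlast, mul_zero, zero_mul, add_zero, ← Finset.sum_add_distrib, poch_succ, poch_succ,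
      show poch A j * (A + j) * (poch B j * (B + j)) = (poch A j * poch B j) * ((A + j) * (B + j))
        by ring, ih, Finset.sum_mul]
    refine Finset.sum_congr rfl fun i _ => ?_
    simp only [hQ, poch_succ, hw, ht]
    ring

/-- A terminating Thomae-type transformation of a `₃F₂` at `1`. -/
theorem thomae_transformation (n : ℕ) (A B D E : ℂ) (hD : poch D n ≠ 0)
    (hE : ∀ j ≤ n, poch E j ≠ 0) :
    ∑ j ∈ Finset.range (n + 1),
        (-1) ^ j * (n.choose j : ℂ) * (poch A j * poch B j) / (poch D j * poch E j)
      = 1 / poch D n * ∑ i ∈ Finset.range (n + 1),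
        (-1) ^ i * (n.choose i : ℂ) * poch (D + E - A - B + i) (n - i) / poch E i
          * (poch (E - A) i * poch (E - B) i) := by
  have hterm : ∀ j ∈ Finset.range (n + 1),
      (-1) ^ j * (n.choose j : ℂ) * (poch A j * poch B j) / (poch D j * poch E j)
        = ∑ i ∈ Finset.range (n + 1), 1 / poch D n * ((-1) ^ j * (n.choose j : ℂ) * (j.choose i : ℂ)
            * poch (A + B - E) (j - i) * poch (D + j) (n - j))
            * (poch (E - A) i * poch (E - B) i / poch E i) := by
    intro j hj
    have hj : j ≤ n := by simpa [Nat.lt_succ_iff] using hj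
    rw [pfaff_saalschutz A B E j, ← sum_range_extend _ hj (fun i hi => by
      simp [Nat.choose_eq_zero_of_lt hi]), Finset.mul_sum, Finset.sum_div]
    refine Finset.sum_congr rfl fun i hi => ?_
    have hi : i ≤ j := by simpa [Nat.lt_succ_iff] using hi
    have hDj : poch D n = poch D j * poch (D + j) (n - j) := by
      rw [← poch_add, Nat.add_sub_cancel' hj]
    have hEj : poch E j = poch E i * poch (E + i) (j - i) := by
      rw [← poch_add, Nat.add_sub_cancel' hi]
    have h1 := hE j hj
    rw [hDj] at hD ⊢
    rw [hEj] at h1 ⊢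
    obtain ⟨_, _⟩ := mul_ne_zero_iff.1 hD
    obtain ⟨_, _⟩ := mul_ne_zero_iff.1 h1
    field_simp
  rw [Finset.sum_congr rfl hterm, Finset.sum_comm, Finset.mul_sum]
  refine Finset.sum_congr rfl fun i hi => ?_
  have hi : i ≤ n := by simpa [Nat.lt_succ_iff] using hi
  rw [← Finset.sum_mul, ← Finset.mul_sum, sum_range_eq_sum_shift _ hi (fun j hj => by
      simp [Nat.choose_eq_zero_of_lt hj]),
    show D + E - A - B + i = (D + i) - (A + B - E) by ring,
    ← chu_vandermonde (n - i) (A + B - E)]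
  have hinner : ∀ m ∈ Finset.range (n - i + 1),
      (-1) ^ (i + m) * (n.choose (i + m) : ℂ) * ((i + m).choose i : ℂ)
          * poch (A + B - E) (i + m - i) * poch (D + (i + m : ℕ)) (n - (i + m))
        = (-1) ^ i * (n.choose i : ℂ) * ((-1) ^ m * ((n - i).choose m : ℂ)
          * poch (A + B - E) m * poch (D + i + m) (n - i - m)) := by
    intro m hm
    have hc := congrArg (Nat.cast : ℕ → ℂ)
      (Nat.choose_mul (n := n) (k := i + m) (s := i) (Nat.le_add_right i m))
    rw [Nat.add_sub_cancel_left] at hc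
    push_cast at hc ⊢
    rw [Nat.add_sub_cancel_left, Nat.sub_sub, ← add_assoc, pow_add]
    linear_combination (-1) ^ i * (-1) ^ m * poch (A + B - E) m
      * poch (D + i + m) (n - (i + m)) * hc
  rw [Finset.sum_congr rfl hinner, ← Finset.mul_sum]
  ring

/-- The summand `(b)ₖ(-N)ₖ / (k!(b+1+N)ₖ) · (-k)ᵢ(k+b)ᵢ · (k-N)ⱼ(-b-N-k)ⱼ` pairing two Newton-type
bases of polynomials in `k(k+b)`. -/
noncomputable def pairingTerm (b : ℂ) (N i j k : ℕ) : ℂ :=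
  poch b k * poch (-(N : ℂ)) k / ((k.factorial : ℂ) * poch (b + 1 + N) k)
    * (poch (-(k : ℂ)) i * poch (k + b) i) * (poch (k - N) j * poch (-b - N - k) j)

theorem pairingTerm_succ (b : ℂ) (N i j k : ℕ) (hk : b + 1 + N + k ≠ 0) :
    (k + 1 - i) * (b + N + k + 1 - j) * pairingTerm b N i j (k + 1)
      = (k - N + j) * (k + b + i) * pairingTerm b N i j k := by
  have e1 := mul_poch_add_one (-((k : ℂ) + 1)) i
  have e2 := mul_poch_add_one (k + b) i
  have e3 := mul_poch_add_one ((k : ℂ) - N) j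
  have e4 := mul_poch_add_one (-b - N - (k + 1)) j
  rw [show -((k : ℂ) + 1) + 1 = -k by ring] at e1
  rw [show (k : ℂ) + b + 1 = k + 1 + b by ring] at e2
  rw [show (k : ℂ) - N + 1 = k + 1 - N by ring] at e3
  rw [show -b - N - ((k : ℂ) + 1) + 1 = -b - N - k by ring] at e4
  have hk1 : (k : ℂ) + 1 ≠ 0 := Nat.cast_add_one_ne_zero k
  simp only [pairingTerm, poch_succ, Nat.factorial_succ]
  push_cast
  calc _ = poch b k * poch (-(N : ℂ)) k / ((k.factorial : ℂ) * poch (b + 1 + N) k)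
        * (poch (-((k : ℂ) + 1)) i * (-((k : ℂ) + 1) + i)) * ((k + b) * poch (k + 1 + b) i)
        * ((k - N) * poch (k + 1 - N) j)
        * (poch (-b - N - ((k : ℂ) + 1)) j * (-b - N - ((k : ℂ) + 1) + j))
        / ((k + 1) * (b + 1 + N + k)) := by
        simp only [div_eq_mul_inv, mul_inv]
        ring
    _ = _ := by
        rw [← e1, e2, e3, ← e4]
        generalize (k.factorial : ℂ) * poch (b + 1 + N) k = q
        rw [div_eq_iff (mul_ne_zero hk1 hk)]
        ring

/-- The telescoped partial sums of the very-well-poised sum. -/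
theorem sum_pairingTerm_range (b : ℂ) (N i j K : ℕ) (hb : ∀ k < K, b + 1 + N + k ≠ 0) :
    (N - i - j) * ∑ k ∈ Finset.range K, (2 * k + b) * pairingTerm b N i j k
      = -((K - i) * (b + N + K - j) * pairingTerm b N i j K) := by
  induction K with
  | zero =>
    rcases Nat.eq_zero_or_pos i with rfl | hi
    · rcases Nat.eq_zero_or_pos j with rfl | hj
      · simp
      · simp
    · have := poch_neg_natCast_of_lt hi
      simp only [Nat.cast_zero, neg_zero] at this
      simp [pairingTerm, this]
  | succ K ih =>
    have h := pairingTerm_succ b N i j K (hb K K.lt_succ_self)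
    rw [Finset.sum_range_succ, mul_add, ih fun k hk => hb k (hk.trans K.lt_succ_self)]
    push_cast
    rw [show b + N + ((K : ℂ) + 1) - j = b + N + K + 1 - j by ring, h]
    ring

theorem sum_pairingTerm_eq_zero (b : ℂ) (N i j : ℕ) (hb : ∀ k < N, b + 1 + N + k ≠ 0)
    (hij : i + j ≠ N) :
    ∑ k ∈ Finset.range (N + 1), (2 * k + b) * pairingTerm b N i j k = 0 := by
  have hne : (N : ℂ) - i - j ≠ 0 := by
    intro h
    apply hij
    have : (N : ℂ) = (i + j : ℕ) := by
      push_cast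
      linear_combination h
    exact_mod_cast this.symm
  have hj : (j : ℂ) * pairingTerm b N i j N = 0 := by
    rcases Nat.eq_zero_or_pos j with rfl | hj
    · simp
    · have := poch_neg_natCast_of_lt hj
      simp only [Nat.cast_zero, neg_zero] at this
      simp [pairingTerm, this]
  refine (mul_eq_zero.1 ?_).resolve_left hne
  rw [Finset.sum_range_succ, mul_add, sum_pairingTerm_range b N i j N hb]
  linear_combination (-(N + b + i)) * hj

theorem sum_pairingTerm_of_add_eq (b : ℂ) (i j : ℕ)
    (hb : ∀ k < i + j, b + 1 + (i + j : ℕ) + k ≠ 0) :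
    ∑ k ∈ Finset.range (i + j + 1), (2 * k + b) * pairingTerm b (i + j) i j k
      = poch b (i + j + 1) * (i + j).factorial := by
  have hlt : ∀ k < i, pairingTerm b (i + j) i j k = 0 := fun k hk => by
    simp [pairingTerm, poch_neg_natCast_of_lt hk]
  rw [sum_range_eq_sum_shift _ (Nat.le_add_right i j) fun k hk => by rw [hlt k hk, mul_zero],
    Nat.add_sub_cancel_left, Finset.sum_range_succ', Finset.sum_eq_zero, zero_add]
  · rw [add_zero, pairingTerm]
    have hi : poch (-(i : ℂ)) i = (-1) ^ i * i.factorial := by simp [poch_neg_natCast]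
    have hj : poch (-((i + j : ℕ) : ℂ)) i * poch (i - (i + j : ℕ)) j
        = (-1) ^ (i + j) * (i + j).factorial := by
      have h := poch_add (-((i + j : ℕ) : ℂ)) i j
      rw [poch_neg_natCast, Nat.choose_self, Nat.cast_one, one_mul, neg_add_eq_sub] at h
      exact h.symm
    have hr := poch_reflect (-b - (i + j : ℕ) - i) j
    rw [show 1 - (-b - ((i + j : ℕ) : ℂ) - i) - j = b + i + i + 1 by push_cast; ring] at hr
    have hprod : poch b i * (poch (i + b) i * (b + i + i)) * poch (b + i + i + 1) j
        = poch b (i + j + 1) * poch (b + 1 + (i + j : ℕ)) i := by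
      rw [add_comm (i : ℂ) b, ← poch_succ, ← poch_add,
        show b + 1 + ((i + j : ℕ) : ℂ) = b + (i + j + 1 : ℕ) by push_cast; ring, ← poch_add,
        show b + i + i + 1 = b + (i + (i + 1) : ℕ) by push_cast; ring, ← poch_add]
      congr 1
      omega
    have hne : poch (b + 1 + (i + j : ℕ)) i ≠ 0 :=
      poch_ne_zero fun k hk => hb k (hk.trans_le (Nat.le_add_right i j))
    have hfac : (i.factorial : ℂ) ≠ 0 := Nat.cast_ne_zero.2 i.factorial_ne_zero
    have hsq : ((-1 : ℂ) ^ i) ^ 2 = 1 ∧ ((-1 : ℂ) ^ j) ^ 2 = 1 := by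
      constructor <;> rw [← pow_mul, mul_comm, pow_mul] <;> simp
    calc _ = (poch (-((i + j : ℕ) : ℂ)) i * poch (i - (i + j : ℕ)) j)
          * (poch b i * (poch (i + b) i * (b + i + i)) * poch (b + i + i + 1) j)
          * ((-1) ^ i * (-1) ^ j) * i.factorial
          / (i.factorial * poch (b + 1 + (i + j : ℕ)) i) := by
          rw [hi, hr]
          simp only [div_eq_mul_inv]
          ring
      _ = _ := by
          rw [hj, hprod, pow_add, div_eq_iff (mul_ne_zero hfac hne)]
          linear_combination ((i + j).factorial * poch b (i + j + 1)
            * poch (b + 1 + (i + j : ℕ)) i * i.factorial) * (((-1 : ℂ) ^ j) ^ 2 * hsq.1 + hsq.2)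
  · intro m hm
    have hm : m < j := Finset.mem_range.1 hm
    have h : poch (-((j - (m + 1) : ℕ) : ℂ)) j = 0 := poch_neg_natCast_of_lt (by omega)
    rw [Nat.cast_sub (by omega)] at h
    have h' : poch (((i + (m + 1) : ℕ) : ℂ) - (i + j : ℕ)) j = 0 := by
      rw [← h]
      congr 1
      push_cast
      ring
    simp only [pairingTerm, h']
    ring

theorem one_div_hahnH (a : ℂ) (N k : ℕ) :
    1 / hahnH a N k = (-1) ^ N / poch (2 * a - 1) (N + 1)
      * ((2 * k + (2 * a - 1)) * (poch (2 * a - 1) k * poch (-(N : ℂ)) k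
        / ((k.factorial : ℂ) * poch (2 * a - 1 + 1 + N) k))) := by
  have h : ((-1 : ℂ) ^ N)⁻¹ = (-1) ^ N := by rw [← inv_pow]; norm_num
  rw [one_div, hahnH, poch_succ_left, sub_add_cancel, show 1 - 2 * a = -(2 * a - 1) by ring,
    show -(2 * a - 1) - 2 * (k : ℂ) = -(2 * k + (2 * a - 1)) by ring]
  simp only [div_eq_mul_inv, mul_inv, inv_inv, inv_neg, h]
  ring

/-- Orthogonality of the two Newton-type bases with respect to the weight `1 / hₖ`. -/
theorem sum_one_div_hahnH (a : ℂ) (N i j : ℕ) (ha : ∀ k < N, 2 * a + N + k ≠ 0)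
    (h0 : poch (2 * a - 1) (N + 1) ≠ 0) :
    ∑ k ∈ Finset.range (N + 1), 1 / hahnH a N k
        * (poch (-(k : ℂ)) i * poch (k + 2 * a - 1) i)
        * (poch (-(N : ℂ) + k) j * poch (-(N : ℂ) - (k + 2 * a - 1)) j)
      = if i + j = N then (-1) ^ N * (N.factorial : ℂ) else 0 := by
  have hterm : ∀ k ∈ Finset.range (N + 1), 1 / hahnH a N k
        * (poch (-(k : ℂ)) i * poch (k + 2 * a - 1) i)
        * (poch (-(N : ℂ) + k) j * poch (-(N : ℂ) - (k + 2 * a - 1)) j)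
      = (-1) ^ N / poch (2 * a - 1) (N + 1)
        * ((2 * k + (2 * a - 1)) * pairingTerm (2 * a - 1) N i j k) := by
    intro k _
    rw [one_div_hahnH, pairingTerm, neg_add_eq_sub, add_sub_assoc (k : ℂ),
      show -(N : ℂ) - (k + (2 * a - 1)) = -(2 * a - 1) - N - k by ring]
    ring
  have hb : ∀ k < N, 2 * a - 1 + 1 + N + k ≠ 0 := by simpa using ha
  rw [Finset.sum_congr rfl hterm, ← Finset.mul_sum]
  split_ifs with hij
  · subst hij
    rw [sum_pairingTerm_of_add_eq _ _ _ hb]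
    field_simp
  · rw [sum_pairingTerm_eq_zero _ _ _ _ hb hij, mul_zero]

theorem hahnU_natCast (a c' : ℂ) {N k n : ℕ} (hk : k ≤ N) (hn : n ≤ N) :
    hahnU a c' N k n = ∑ j ∈ Finset.range (n + 1), (-1) ^ j * (n.choose j : ℂ)
      * (poch (-(k : ℂ)) j * poch (k + 2 * a - 1) j) / (poch (a - c' - n) j * poch (-(N : ℂ)) j) := by
  rw [hahnU, sum_range_extend _ hk fun j hj => by simp [poch_neg_natCast_of_lt hj],
    sum_range_extend _ hn fun j hj => by simp [Nat.choose_eq_zero_of_lt hj]]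
  refine Finset.sum_congr rfl fun j _ => ?_
  have hfac : (j.factorial : ℂ) ≠ 0 := Nat.cast_ne_zero.2 j.factorial_ne_zero
  rw [poch_neg_natCast n, mul_comm (poch (a - c' - n) j * _), ← div_div]
  congr 1
  field_simp

/-- The expansion of `Uₖ(N - ℓ'; a, -c-N, N)` in the second Newton-type basis. -/
theorem hahnU_reflected (a c : ℂ) {N k l' : ℕ} (hk : k ≤ N) (hl' : l' ≤ N)
    (hD : poch (a + c + l') (N - l') ≠ 0) :
    hahnU a (-c - N) N k ((N : ℂ) - l') = 1 / poch (a + c + l') (N - l')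
      * ∑ j ∈ Finset.range (N + 1), (-1) ^ j * ((N - l').choose j : ℂ)
        * poch (1 - (a - c) + l' - N + j) (N - l' - j) / poch (-(N : ℂ)) j
        * (poch (-(N : ℂ) + k) j * poch (-(N : ℂ) - (k + 2 * a - 1)) j) := by
  have hn : N - l' ≤ N := Nat.sub_le N l'
  have hbase : a - (-c - N) - ((N - l' : ℕ) : ℂ) = a + c + l' := by
    push_cast [Nat.cast_sub hl']
    ring
  rw [← Nat.cast_sub hl', hahnU_natCast a _ hk hn, hbase,
    thomae_transformation _ _ _ _ _ hD fun j hj => poch_neg_natCast_ne_zero (hj.trans hn),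
    ← sum_range_extend _ hn fun j hj => by simp [Nat.choose_eq_zero_of_lt hj]]
  refine congrArg _ (Finset.sum_congr rfl fun j _ => ?_)
  rw [sub_neg_eq_add (-(N : ℂ)),
    show a + c + l' + -(N : ℂ) - -k - (k + 2 * a - 1) + j = 1 - (a - c) + l' - N + j by ring]

/-- The product of coefficients on the antidiagonal `i + j = N`, for `ℓ = p + M`, `ℓ' = p`,
`N = p + M + r` and `i = p + m`, `M = m + s`. -/
theorem antidiagonal_coeff (y : ℂ) (p r m s : ℕ)
    (hy : poch (y + 1 - (p + (m + s) : ℕ)) (p + (m + s)) ≠ 0) :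
    (-1) ^ (p + m) * ((p + (m + s)).choose (p + m) : ℂ)
        / (poch (y + 1 - (p + (m + s) : ℕ)) (p + m)
          * poch (-((p + (m + s) + r : ℕ) : ℂ)) (p + m))
      * ((-1) ^ (s + r) * ((m + s + r).choose (s + r) : ℂ) * poch (1 - y - m) m
        / poch (-((p + (m + s) + r : ℕ) : ℂ)) (s + r))
      = (p + (m + s)).factorial * (m + s + r).factorial
          / ((m + s).factorial * (p + (m + s) + r).factorial ^ 2
            * poch (y + 1 - (p + (m + s) : ℕ)) (p + (m + s)))
        * ((-1) ^ m * ((m + s).choose m : ℂ) * poch y m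
          * poch (y + 1 - (m + s : ℕ) + m) s) := by
  have hsplit : poch (y + 1 - (p + (m + s) : ℕ)) (p + (m + s))
      = poch (y + 1 - (p + (m + s) : ℕ)) (p + m) * poch (y + 1 - (m + s : ℕ) + m) s := by
    rw [← add_assoc, poch_add]
    congr 2
    push_cast
    ring
  have hr : poch (1 - y - m) m = (-1) ^ m * poch y m := by
    rw [poch_reflect]
    congr 2
    ring
  have hc : ∀ u v w : ℕ, u + v = w → (w.choose u : ℂ) = w.factorial / (u.factorial * v.factorial) :=
    fun u v w h => h ▸ Nat.cast_add_choose ℂ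
  have hf : ∀ n : ℕ, (n.factorial : ℂ) ≠ 0 := fun n => Nat.cast_ne_zero.2 n.factorial_ne_zero
  rw [hsplit] at hy
  obtain ⟨hy1, hy2⟩ := mul_ne_zero_iff.1 hy
  rw [hsplit, hr, poch_neg_natCast, poch_neg_natCast]
  have hs : ∀ n : ℕ, (-1 : ℂ) ^ n ≠ 0 := fun n => pow_ne_zero _ (by norm_num)
  have h1 := hf (p + m)
  have h2 := hf (s + r)
  have h3 := hf (m + s)
  have h4 := hf (p + (m + s) + r)
  have h5 := hf m
  have h6 := hf s
  have h7 := hs (p + m)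
  have h8 := hs (s + r)
  rw [hc (p + m) s _ (by ring), hc (s + r) m _ (by ring), hc m s _ rfl,
    hc (p + m) (s + r) _ (by ring), hc (s + r) (p + m) _ (by ring)]
  field_simp

theorem sum_antidiagonal_coeff (y : ℂ) {N l l' : ℕ} (hl : l ≤ N) (hl' : l' ≤ N)
    (hy : poch (y + 1 - l) l ≠ 0) :
    ∑ i ∈ Finset.range (l + 1),
        (-1) ^ i * (l.choose i : ℂ) / (poch (y + 1 - l) i * poch (-(N : ℂ)) i)
        * ((-1) ^ (N - i) * ((N - l').choose (N - i) : ℂ)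
          * poch (1 - y + l' - N + (N - i : ℕ)) (N - l' - (N - i)) / poch (-(N : ℂ)) (N - i))
      = if l = l' then l.factorial * (N - l).factorial
          / ((N.factorial : ℂ) ^ 2 * poch (y + 1 - l) l) else 0 := by
  have hlow : ∀ i < l', (N - l').choose (N - i) = 0 := fun i hi =>
    Nat.choose_eq_zero_of_lt (by omega)
  rcases lt_or_ge l l' with h | h
  · rw [if_neg h.ne, Finset.sum_eq_zero]
    intro i hi
    simp [hlow i ((Nat.lt_succ_iff.1 (Finset.mem_range.1 hi)).trans_lt h)]
  obtain ⟨M, rfl⟩ := Nat.exists_eq_add_of_le h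
  obtain ⟨r, rfl⟩ := Nat.exists_eq_add_of_le hl
  rw [sum_range_eq_sum_shift _ h fun i hi => by simp [hlow i hi], Nat.add_sub_cancel_left]
  trans ∑ m ∈ Finset.range (M + 1), (l' + M).factorial * (M + r).factorial
          / (M.factorial * (l' + M + r).factorial ^ 2
            * poch (y + 1 - (l' + M : ℕ)) (l' + M))
        * ((-1) ^ m * (M.choose m : ℂ) * poch y m * poch (y + 1 - M + m) (M - m))
  · refine Finset.sum_congr rfl fun m hm => ?_
    obtain ⟨s, rfl⟩ := Nat.exists_eq_add_of_le (Nat.lt_succ_iff.1 (Finset.mem_range.1 hm))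
    rw [Nat.add_sub_cancel_left, ← antidiagonal_coeff y l' r m s hy,
      show l' + (m + s) + r - (l' + m) = s + r by omega,
      show l' + (m + s) + r - l' = m + s + r by omega,
      show m + s + r - (s + r) = m by omega,
      show 1 - y + l' - ((l' + (m + s) + r : ℕ) : ℂ) + (s + r : ℕ) = 1 - y - m by push_cast; ring]
  rw [← Finset.mul_sum, chu_vandermonde, show y + 1 - M - y = 1 - (M : ℂ) by ring]
  cases M with
  | zero => simp [poch_zero]
  | succ M =>
    have h : poch (-(M : ℂ)) (M + 1) = 0 := poch_neg_natCast_of_lt M.lt_succ_self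
    rw [if_neg (by omega), show 1 - ((M + 1 : ℕ) : ℂ) = -M by push_cast; ring, h, mul_zero]

/-- Dual biorthogonality of the Hahn rational functions:
`Σ_{k=0}^{N} (1/hₖ) Uₖ(ℓ; a, c-1, N) Uₖ(N-ℓ'; a, -c-N, N) = δ_{ℓ,ℓ'} / W(ℓ)`. -/
theorem hahn_rational_dual_biorthogonality (a c : ℂ) (N : ℕ) (hN : 1 ≤ N)
    (hac : ∀ m ≤ 2 * N, a + c + (m : ℂ) ≠ 0)
    (h1 : ∀ l ≤ N, ∀ i ≤ N - 1, a - c + 1 - (l : ℂ) + (i : ℂ) ≠ 0)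
    (h2 : ∀ i ≤ N - 1, 2 * a + (i : ℂ) ≠ 0)
    (h3 : ∀ i ≤ N - 1, 2 * a + (N : ℂ) + (i : ℂ) ≠ 0)
    (h4 : ∀ k ≤ N, 2 * a - 1 - 2 * (k : ℂ) ≠ 0)
    (h5 : ∀ k ≤ N, poch (2 * a - 1) k ≠ 0)
    (hW : ∀ l ≤ N, hahnW a c N l ≠ 0)
    (hh : ∀ k ≤ N, hahnH a N k ≠ 0)
    (l l' : ℕ) (hl : l ≤ N) (hl' : l' ≤ N) :
    ∑ k ∈ Finset.range (N + 1),
        (1 / hahnH a N k) * hahnU a (c - 1) N k (l : ℂ)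
          * hahnU a (-c - N) N k ((N : ℂ) - l')
      = if l = l' then 1 / hahnW a c N l else 0 := by
  have hD : poch (a + c + l') (N - l') ≠ 0 := poch_ne_zero fun i hi => by
    have := hac (l' + i) (by omega)
    rwa [Nat.cast_add, ← add_assoc] at this
  have hy : poch (a - c + 1 - l) l ≠ 0 := poch_ne_zero fun i hi => h1 l hl i (by omega)
  have hpos : poch (2 * a - 1) (N + 1) ≠ 0 := by
    have hone : 2 * a - 1 ≠ 0 := by
      simpa [poch_succ, poch_zero] using h5 1 hN
    rw [poch_succ_left, sub_add_cancel]
    exact mul_ne_zero hone (poch_ne_zero fun i hi => h2 i (by omega))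
  set y := a - c with hy_def
  set α : ℕ → ℂ := fun i =>
    (-1) ^ i * (l.choose i : ℂ) / (poch (y + 1 - l) i * poch (-(N : ℂ)) i) with hα
  set β : ℕ → ℂ := fun j => (-1) ^ j * ((N - l').choose j : ℂ)
    * poch (1 - y + l' - N + j) (N - l' - j) / poch (-(N : ℂ)) j with hβ
  set P : ℕ → ℕ → ℂ := fun i k => poch (-(k : ℂ)) i * poch (k + 2 * a - 1) i with hP
  set Q : ℕ → ℕ → ℂ := fun j k =>
    poch (-(N : ℂ) + k) j * poch (-(N : ℂ) - (k + 2 * a - 1)) j with hQ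
  have hterm : ∀ k ∈ Finset.range (N + 1),
      (1 / hahnH a N k) * hahnU a (c - 1) N k (l : ℂ) * hahnU a (-c - N) N k ((N : ℂ) - l')
        = ∑ i ∈ Finset.range (l + 1), ∑ j ∈ Finset.range (N + 1),
          1 / poch (a + c + l') (N - l') * (α i * β j) * (1 / hahnH a N k * P i k * Q j k) := by
    intro k hk
    have hk : k ≤ N := Nat.lt_succ_iff.1 (Finset.mem_range.1 hk)
    rw [hahnU_natCast a _ hk hl, hahnU_reflected a c hk hl' hD,
      show a - (c - 1) - l = y + 1 - l by ring, Finset.mul_sum, Finset.sum_mul]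
    refine Finset.sum_congr rfl fun i _ => ?_
    rw [Finset.mul_sum, Finset.mul_sum]
    refine Finset.sum_congr rfl fun j _ => ?_
    simp only [hα, hβ, hP, hQ]
    ring
  have hinner : ∀ i ∈ Finset.range (l + 1), ∑ j ∈ Finset.range (N + 1),
      ∑ k ∈ Finset.range (N + 1),
        1 / poch (a + c + l') (N - l') * (α i * β j) * (1 / hahnH a N k * P i k * Q j k)
      = 1 / poch (a + c + l') (N - l') * ((-1) ^ N * N.factorial) * (α i * β (N - i)) := by
    intro i hi
    have hi : i ≤ l := Nat.lt_succ_iff.1 (Finset.mem_range.1 hi)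
    simp only [← Finset.mul_sum]
    rw [Finset.sum_eq_single_of_mem (N - i) (by simp)]
    · rw [sum_one_div_hahnH a N _ _ (fun k hk => h3 k (by omega)) hpos, if_pos (by omega)]
      ring
    · intro j _ hj
      rw [sum_one_div_hahnH a N _ _ (fun k hk => h3 k (by omega)) hpos, if_neg (by omega), mul_zero]
  rw [Finset.sum_congr rfl hterm, Finset.sum_comm,
    Finset.sum_congr rfl fun i _ => Finset.sum_comm, Finset.sum_congr rfl hinner, ← Finset.mul_sum,
    sum_antidiagonal_coeff y hl hl' hy]
  split_ifs with h
  · subst h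
    have e1 : poch (1 - a - c - N) (N - l) = (-1) ^ (N - l) * poch (a + c + l) (N - l) := by
      rw [poch_reflect, Nat.cast_sub hl]
      congr 2
      ring
    have e2 : poch (c - a) l = (-1) ^ l * poch (y + 1 - l) l := by
      rw [poch_reflect]
      congr 2
      rw [hy_def]
      ring
    have e3 : (-1 : ℂ) ^ N = (-1) ^ (N - l) * (-1) ^ l := by rw [← pow_add, Nat.sub_add_cancel hl]
    have hsq : ∀ n : ℕ, ((-1 : ℂ) ^ n) ^ 2 = 1 := fun n => by
      rw [← pow_mul, mul_comm, pow_mul]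
      simp
    have hf : ∀ n : ℕ, (n.factorial : ℂ) ≠ 0 := fun n => Nat.cast_ne_zero.2 n.factorial_ne_zero
    have hs : ∀ n : ℕ, (-1 : ℂ) ^ n ≠ 0 := fun n => pow_ne_zero _ (by norm_num)
    have h6 := hf N
    have h7 := hf l
    have h8 := hf (N - l)
    have h9 := hs l
    have h10 := hs (N - l)
    rw [hahnW, e1, e2, e3, Nat.cast_choose ℂ hl]
    field_simp
    linear_combination hsq (N - l) * ((-1 : ℂ) ^ l) ^ 2 + hsq l
  · rw [mul_zero]
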